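/- Let p ∈ AdS^{n+1} with p₂ ≠ p₄. Then {X·p : X ∈ 𝔞 + 𝔫} = {v ∈ ℝ^{n+2} : ⟨v,p⟩ = 0}; moreover, for all a,b ∈ ℝ, H_{a,b}·p ∈ {X·p : X ∈ 𝔫} if and only if b = 0. (Hence AN acts on AdS^{n+1} with cohomogeneity zero, and the only Lie subalgebras 𝔥 with 𝔫 ⊆ 𝔥 ⊆ 𝔞 ⊕ 𝔫 acting with cohomogeneity one are 𝔫 and ℝH_{1,0} ⊕ 𝔫.) -/

import Mathlib

open Matrix

noncomputable section

/-- Index type for `ℝ^{2,n} = ℝ^{n+2}`, split as the first four coordinates plus the remaining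
`n - 2` coordinates.  `Sum.inl 0, …, Sum.inl 3` are the coordinates `1, …, 4` of the paper. -/
abbrev Idx (n : ℕ) := Fin 4 ⊕ Fin (n - 2)

/-- The scalar product `⟨x,y⟩ = −x₁y₁ − x₂y₂ + x₃y₃ + ⋯ + x_{n+2}y_{n+2}` of `ℝ^{2,n}`. -/
def ip (n : ℕ) (x y : Idx n → ℝ) : ℝ :=
  -(x (Sum.inl 0) * y (Sum.inl 0)) - x (Sum.inl 1) * y (Sum.inl 1)
    + x (Sum.inl 2) * y (Sum.inl 2) + x (Sum.inl 3) * y (Sum.inl 3)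
    + ∑ j, x (Sum.inr j) * y (Sum.inr j)

/-- The matrix `H_{a,b} ∈ 𝔞`. -/
def Hmat (n : ℕ) (a b : ℝ) : Matrix (Idx n) (Idx n) ℝ :=
  Matrix.fromBlocks !![0,0,a,0; 0,0,0,b; a,0,0,0; 0,b,0,0] 0 0 0

/-- The matrix `X(a,b,v,w) ∈ 𝔫 ⊆ so(2,n)`. -/
def Xmat (n : ℕ) (a b : ℝ) (v w : Fin (n - 2) → ℝ) : Matrix (Idx n) (Idx n) ℝ :=
  Matrix.fromBlocks
    !![0, b+a, 0, -b-a; -b-a, 0, -b+a, 0; 0, -b+a, 0, b-a; -b-a, 0, -b+a, 0]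
    (Matrix.of fun i j => ![v j, w j, v j, w j] i)
    (Matrix.of fun j i => ![v j, w j, -v j, -w j] i)
    0

theorem Hmat_mulVec (n : ℕ) (a b : ℝ) (p : Idx n → ℝ) :
    (Hmat n a b).mulVec p =
      Sum.elim ![a * p (Sum.inl 2), b * p (Sum.inl 3), a * p (Sum.inl 0), b * p (Sum.inl 1)] 0 := by
  rw [Hmat, fromBlocks_mulVec]
  congr 1
  · ext i
    fin_cases i <;> simp [dotProduct, Fin.sum_univ_four]
  · simp

theorem Xmat_mulVec (n : ℕ) (a b : ℝ) (v w : Fin (n - 2) → ℝ) (p : Idx n → ℝ) :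
    (Xmat n a b v w).mulVec p =
      Sum.elim
        ![(a + b) * (p (Sum.inl 1) - p (Sum.inl 3)) + ∑ j, v j * p (Sum.inr j),
          -(a + b) * p (Sum.inl 0) + (a - b) * p (Sum.inl 2) + ∑ j, w j * p (Sum.inr j),
          (a - b) * (p (Sum.inl 1) - p (Sum.inl 3)) + ∑ j, v j * p (Sum.inr j),
          -(a + b) * p (Sum.inl 0) + (a - b) * p (Sum.inl 2) + ∑ j, w j * p (Sum.inr j)]
        (fun j => v j * (p (Sum.inl 0) - p (Sum.inl 2))
          + w j * (p (Sum.inl 1) - p (Sum.inl 3))) := by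
  rw [Xmat, fromBlocks_mulVec]
  congr 1
  · ext i
    fin_cases i <;> simp [mulVec, dotProduct, Fin.sum_univ_four] <;> ring
  · ext j
    simp [mulVec, dotProduct, Fin.sum_univ_four]
    ring

/-- Every element of `𝔞 + 𝔫` is skew for the scalar product. -/
theorem ip_Hmat_add_Xmat_mulVec (n : ℕ) (a' b' a b : ℝ) (v w : Fin (n - 2) → ℝ)
    (p : Idx n → ℝ) : ip n ((Hmat n a' b' + Xmat n a b v w).mulVec p) p = 0 := by
  have hsum : ∑ j, (v j * (p (Sum.inl 0) - p (Sum.inl 2))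
        + w j * (p (Sum.inl 1) - p (Sum.inl 3))) * p (Sum.inr j)
      = (p (Sum.inl 0) - p (Sum.inl 2)) * ∑ j, v j * p (Sum.inr j)
        + (p (Sum.inl 1) - p (Sum.inl 3)) * ∑ j, w j * p (Sum.inr j) := by
    rw [Finset.mul_sum, Finset.mul_sum, ← Finset.sum_add_distrib]
    exact Finset.sum_congr rfl fun j _ => by ring
  simp only [add_mulVec, Hmat_mulVec, Xmat_mulVec, ip, Pi.add_apply, Sum.elim_inl, Sum.elim_inr,
    Pi.zero_apply, zero_add, hsum]
  simp
  ring

/-- If `p₂ ≠ p₄`, every vector orthogonal to `p` lies in `(𝔞 + 𝔫)·p`. -/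
theorem exists_eq_mulVec_of_ip_eq_zero (n : ℕ) {p y : Idx n → ℝ}
    (hp24 : p (Sum.inl 1) ≠ p (Sum.inl 3)) (hy : ip n y p = 0) :
    ∃ (a' b' a b : ℝ) (v w : Fin (n - 2) → ℝ),
      y = (Hmat n a' b' + Xmat n a b v w).mulVec p := by
  have hd : p (Sum.inl 1) - p (Sum.inl 3) ≠ 0 := sub_ne_zero.mpr hp24
  set d := p (Sum.inl 1) - p (Sum.inl 3) with hd_def
  have hsum : ∑ j, y (Sum.inr j) / d * p (Sum.inr j)
      = (∑ j, y (Sum.inr j) * p (Sum.inr j)) / d := by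
    rw [Finset.sum_div]
    exact Finset.sum_congr rfl fun j _ => by ring
  unfold ip at hy
  refine ⟨0, -(y (Sum.inl 1) - y (Sum.inl 3)) / d, (y (Sum.inl 0) + y (Sum.inl 2)) / (2 * d),
    (y (Sum.inl 0) - y (Sum.inl 2)) / (2 * d), 0, fun j => y (Sum.inr j) / d, ?_⟩
  rw [add_mulVec, Hmat_mulVec, Xmat_mulVec, ← hd_def, hsum]
  ext (i | j)
  · fin_cases i <;> simp <;> field_simp <;> first | ring1 | linear_combination -2 * hy
  · simp [hd]

/-- If `p₂ ≠ p₄`, then `H_{a,b}·p ∈ 𝔫·p` exactly when `b = 0`. -/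
theorem exists_Hmat_mulVec_eq_iff (n : ℕ) {p : Idx n → ℝ}
    (hp24 : p (Sum.inl 1) ≠ p (Sum.inl 3)) (a b : ℝ) :
    (∃ (a' b' : ℝ) (v w : Fin (n - 2) → ℝ),
      (Hmat n a b).mulVec p = (Xmat n a' b' v w).mulVec p) ↔ b = 0 := by
  have hd : p (Sum.inl 1) - p (Sum.inl 3) ≠ 0 := sub_ne_zero.mpr hp24
  simp only [Hmat_mulVec, Xmat_mulVec]
  constructor
  · rintro ⟨a', b', v, w, h⟩
    have h₁ := congrFun h (Sum.inl 1)
    have h₃ := congrFun h (Sum.inl 3)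
    simp only [Sum.elim_inl] at h₁ h₃
    simp at h₁ h₃
    exact (mul_eq_zero.mp (show b * (p (Sum.inl 1) - p (Sum.inl 3)) = 0 by
      linear_combination h₃ - h₁)).resolve_right hd
  · rintro rfl
    set d := p (Sum.inl 1) - p (Sum.inl 3)
    refine ⟨a * (p (Sum.inl 2) + p (Sum.inl 0)) / (2 * d),
      a * (p (Sum.inl 2) - p (Sum.inl 0)) / (2 * d), 0, 0, ?_⟩
    ext (i | j)
    · fin_cases i <;> simp <;> field_simp <;> ring
    · simp

/-- If `p ∈ AdS^{n+1}` has `p₂ ≠ p₄`, then `(𝔞 + 𝔫)·p = {v : ⟨v,p⟩ = 0}` (so `AN` acts with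
cohomogeneity zero near `p`), and for `a, b ∈ ℝ` one has `H_{a,b}·p ∈ 𝔫·p` iff `b = 0`. -/
theorem stmt_9 (n : ℕ) (hn : 3 ≤ n) (p : Idx n → ℝ) (hp : ip n p p = -1)
    (hp24 : p (Sum.inl 1) ≠ p (Sum.inl 3)) :
    ({y : Idx n → ℝ | ∃ (a' b' a b : ℝ) (v w : Fin (n - 2) → ℝ),
        y = (Hmat n a' b' + Xmat n a b v w).mulVec p}
      = {y : Idx n → ℝ | ip n y p = 0}) ∧
    (∀ a b : ℝ,
      ((Hmat n a b).mulVec p ∈ {y : Idx n → ℝ | ∃ (a' b' : ℝ) (v w : Fin (n - 2) → ℝ),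
        y = (Xmat n a' b' v w).mulVec p}) ↔ b = 0) := by
  exact ⟨Set.ext fun y => ⟨fun ⟨a', b', a, b, v, w, h⟩ =>
      h ▸ ip_Hmat_add_Xmat_mulVec n a' b' a b v w p, exists_eq_mulVec_of_ip_eq_zero n hp24⟩,
    exists_Hmat_mulVec_eq_iff n hp24⟩
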